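/- Let G = (S,B) be a finite graph, q ≥ 1 and r ≥ 0 natural numbers, β ≥ 0 a real number, and set p_β = 1 − e^{−β}. Then the (q,r)-Potts partition function satisfies Z_β(G) = e^{β|B|} · Σ_{X ⊆ B} p_β^{|X|} (1 − p_β)^{|B| − |X|} (q+r)^{κ₀(S,X)} q^{κ₁(S,X)}; that is, Z_β(G) = e^{β|B|} · Z^{RC}_{p_β,q,r}(G), where Z^{RC}_{p,q,r}(G) := Σ_{X ⊆ B} p^{|X|}(1−p)^{|B|−|X|}(q+r)^{κ₀(S,X)} q^{κ₁(S,X)} is the partition function of the r-biased random-cluster model. -/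

import Mathlib

open Classical

noncomputable section

/-- Number of isolated vertices (singleton connected components) of the graph `(S, X)`. -/
def kappa0 {S : Type*} [Fintype S] (X : Finset (Sym2 S)) : ℕ :=
  Nat.card {v : S // ∀ w, ¬ (SimpleGraph.fromEdgeSet (X : Set (Sym2 S))).Adj v w}

/-- Number of connected components of the graph `(S, X)` containing at least two vertices. -/
def kappa1 {S : Type*} [Fintype S] (X : Finset (Sym2 S)) : ℕ :=
  Nat.card {c : (SimpleGraph.fromEdgeSet (X : Set (Sym2 S))).ConnectedComponent //
    1 < Nat.card {v : S //
      (SimpleGraph.fromEdgeSet (X : Set (Sym2 S))).connectedComponentMk v = c}}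

/-- The edge `e` is "good" for the colouring `σ`: both its endpoints carry the same
visible colour (a colour among the first `q` ones). -/
def goodEdge {S : Type*} {n : ℕ} (q : ℕ) (σ : S → Fin n) (e : Sym2 S) : Prop :=
  ∀ i ∈ e, ∀ j ∈ e, σ i = σ j ∧ (σ i : ℕ) < q

namespace SimpleGraph

variable {S : Type*} (H : SimpleGraph S)

theorem exists_adj_iff_exists_ne_reachable (v : S) :
    (∃ w, H.Adj v w) ↔ ∃ w, w ≠ v ∧ H.Reachable v w := by
  constructor
  · rintro ⟨w, hw⟩
    exact ⟨w, hw.ne', hw.reachable⟩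
  · rintro ⟨w, hne, ⟨p⟩⟩
    obtain ⟨x, hx, -, -⟩ := p.exists_eq_cons_of_ne hne.symm
    exact ⟨x, hx⟩

theorem one_lt_card_component_iff [Finite S] (v : S) :
    1 < Nat.card {w : S // H.connectedComponentMk w = H.connectedComponentMk v} ↔
      ∃ w, H.Adj v w := by
  rw [Finite.one_lt_card_iff_nontrivial, exists_adj_iff_exists_ne_reachable]
  constructor
  · intro h
    obtain ⟨⟨w, hw⟩, hne⟩ := exists_ne
      (⟨v, rfl⟩ : {w : S // H.connectedComponentMk w = H.connectedComponentMk v})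
    exact ⟨w, fun h => hne (Subtype.ext h), (ConnectedComponent.eq.mp hw).symm⟩
  · rintro ⟨w, hne, hr⟩
    exact ⟨⟨w, ConnectedComponent.eq.mpr hr.symm⟩, ⟨v, rfl⟩, fun h => hne (congrArg Subtype.val h)⟩

theorem card_isolated_eq_card_trivial_component [Finite S] :
    Nat.card {v : S // ∀ w, ¬ H.Adj v w} =
      Nat.card {c : H.ConnectedComponent //
        ¬ 1 < Nat.card {v : S // H.connectedComponentMk v = c}} := by
  refine Nat.card_congr (Equiv.ofBijective
    (fun v => ⟨H.connectedComponentMk v.1, by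
      rw [one_lt_card_component_iff, not_exists]; exact v.2⟩) ⟨?_, ?_⟩)
  · rintro ⟨v, hv⟩ ⟨w, hw⟩ h
    have hr := ConnectedComponent.eq.mp (congrArg Subtype.val h)
    by_contra hne
    obtain ⟨x, hx⟩ := (H.exists_adj_iff_exists_ne_reachable v).mpr
      ⟨w, fun h => hne (Subtype.ext h.symm), hr⟩
    exact hv x hx
  · rintro ⟨c, hc⟩
    induction c using ConnectedComponent.ind with
    | h v =>
      rw [one_lt_card_component_iff, not_exists] at hc
      exact ⟨⟨v, hc⟩, rfl⟩

/-- Labellings which agree along edges, with values in `P` on non-isolated vertices, are the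
labellings of the components with values in `P` on the non-trivial ones. -/
def edgeConstantLabellingEquiv [Finite S] {α : Type*} (P : α → Prop) :
    {σ : S → α // ∀ v w, H.Adj v w → σ v = σ w ∧ P (σ v)} ≃
      ((c : H.ConnectedComponent) →
        {a : α // 1 < Nat.card {v : S // H.connectedComponentMk v = c} → P a}) where
  toFun σ c := ⟨c.lift σ.1 (fun v w p _ => by
      induction p with
      | nil => rfl
      | cons h p ih => exact (σ.2 _ _ h).1.trans (ih (by simp_all))), by
    induction c using ConnectedComponent.ind with
    | h v =>
      rw [one_lt_card_component_iff]
      rintro ⟨w, hw⟩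
      exact (σ.2 v w hw).2⟩
  invFun τ := ⟨fun v => (τ (H.connectedComponentMk v)).1, fun v w h =>
    ⟨congrArg (fun c => (τ c).1) (ConnectedComponent.eq.mpr h.reachable),
      (τ _).2 ((H.one_lt_card_component_iff v).mpr ⟨w, h⟩)⟩⟩
  left_inv σ := rfl
  right_inv τ := by
    funext c
    induction c using ConnectedComponent.ind with
    | h v => rfl

end SimpleGraph

theorem forall_goodEdge_iff {S : Type*} {n : ℕ} (q : ℕ) (σ : S → Fin n) (X : Finset (Sym2 S))
    (hX : ∀ e ∈ X, ¬ e.IsDiag) :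
    (∀ e ∈ X, goodEdge q σ e) ↔
      ∀ v w, (SimpleGraph.fromEdgeSet (X : Set (Sym2 S))).Adj v w →
        σ v = σ w ∧ (σ v : ℕ) < q := by
  constructor
  · intro h v w hvw
    rw [SimpleGraph.fromEdgeSet_adj] at hvw
    exact h _ hvw.1 v (Sym2.mem_mk_left v w) w (Sym2.mem_mk_right v w)
  · intro h e he
    induction e using Sym2.ind with
    | h x y =>
      have hxy := h x y (by
        rw [SimpleGraph.fromEdgeSet_adj]
        exact ⟨he, fun h => hX _ he (Sym2.mk_isDiag_iff.mpr h)⟩)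
      intro i hi j hj
      rcases Sym2.mem_iff.mp hi with rfl | rfl <;> rcases Sym2.mem_iff.mp hj with rfl | rfl <;>
        grind

theorem card_forall_goodEdge {S : Type*} [Fintype S] (q r : ℕ) (X : Finset (Sym2 S))
    (hX : ∀ e ∈ X, ¬ e.IsDiag) :
    Nat.card {σ : S → Fin (q + r) // ∀ e ∈ X, goodEdge q σ e} =
      (q + r) ^ kappa0 X * q ^ kappa1 X := by
  have hvis : Nat.card {a : Fin (q + r) // (a : ℕ) < q} = q := by
    rw [Nat.card_congr (Fin.castLEquiv (Nat.le_add_right q r)).symm, Nat.card_fin]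
  rw [Nat.card_congr (Equiv.subtypeEquivRight fun σ => forall_goodEdge_iff q σ X hX),
    Nat.card_congr (SimpleGraph.edgeConstantLabellingEquiv _ fun a : Fin (q + r) => (a : ℕ) < q),
    Nat.card_pi, kappa0, SimpleGraph.card_isolated_eq_card_trivial_component, kappa1]
  have hfac (c : (SimpleGraph.fromEdgeSet (X : Set (Sym2 S))).ConnectedComponent) :
      Nat.card {a : Fin (q + r) // 1 < Nat.card {v : S //
        (SimpleGraph.fromEdgeSet (X : Set (Sym2 S))).connectedComponentMk v = c} →
          (a : ℕ) < q} =
      if 1 < Nat.card {v : S //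
        (SimpleGraph.fromEdgeSet (X : Set (Sym2 S))).connectedComponentMk v = c}
      then q else q + r := by
    split_ifs with h
    · simp only [h, forall_const, hvis]
    · rw [Nat.card_congr (Equiv.subtypeUnivEquiv fun a ha => absurd ha h), Nat.card_fin]
  simp_rw [hfac, Finset.prod_ite, Finset.prod_const, Nat.card_eq_fintype_card,
    Fintype.card_subtype]
  exact mul_comm _ _

/-- With `p_β = 1 − e^{−β}`, the `(q,r)`-Potts partition function equals
`e^{β|B|}` times the partition function of the `r`-biased random-cluster model:
`Z_β(G) = e^{β|B|} Σ_{X ⊆ B} p_β^{|X|} (1-p_β)^{|B|-|X|} (q+r)^{κ₀(S,X)} q^{κ₁(S,X)}`. -/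
theorem statement2 {S : Type*} [Fintype S] [DecidableEq S] (q r : ℕ) (hq : 1 ≤ q)
    (B : Finset (Sym2 S)) (hB : ∀ e ∈ B, ¬ e.IsDiag) (β : ℝ) (hβ : 0 ≤ β) :
    ∑ σ : S → Fin (q + r), Real.exp (β * (B.filter (goodEdge q σ)).card)
      = Real.exp (β * B.card) *
          ∑ X ∈ B.powerset,
            (1 - Real.exp (-β)) ^ X.card * (1 - (1 - Real.exp (-β))) ^ (B.card - X.card)
              * (q + r : ℝ) ^ kappa0 X * (q : ℝ) ^ kappa1 X := by
  have hexp (σ : S → Fin (q + r)) :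
      Real.exp (β * (B.filter (goodEdge q σ)).card) = Real.exp (β * B.card) *
        ∑ X ∈ B.powerset, (1 - Real.exp (-β)) ^ X.card *
          (1 - (1 - Real.exp (-β))) ^ (B.card - X.card) *
            (if ∀ e ∈ X, goodEdge q σ e then 1 else 0) := by
    have hprod : Real.exp (β * (B.filter (goodEdge q σ)).card) = Real.exp (β * B.card) *
        ∏ e ∈ B, ((1 - Real.exp (-β)) * (if goodEdge q σ e then 1 else 0) +
          (1 - (1 - Real.exp (-β)))) := by
      rw [mul_comm β (B.card : ℝ), Real.exp_nat_mul, ← Finset.prod_const,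
        ← Finset.prod_mul_distrib, mul_comm β, Real.exp_nat_mul, ← Finset.prod_const,
        Finset.prod_filter]
      refine Finset.prod_congr rfl fun e _ => ?_
      split_ifs
      · ring
      · simp [← Real.exp_add]
    rw [hprod, Finset.prod_add]
    congr 1
    refine Finset.sum_congr rfl fun X hX => ?_
    rw [Finset.prod_mul_distrib, Finset.prod_const, Finset.prod_const,
      Finset.card_sdiff_of_subset (Finset.mem_powerset.mp hX), Finset.prod_ite_zero]
    simp only [Finset.prod_const_one]
    ring
  simp_rw [hexp]
  rw [← Finset.mul_sum, Finset.sum_comm]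
  congr 1
  refine Finset.sum_congr rfl fun X hX => ?_
  rw [← Finset.mul_sum, mul_assoc _ _ ((q : ℝ) ^ kappa1 X)]
  congr 1
  have hcard := card_forall_goodEdge q r X fun e he => hB e (Finset.mem_powerset.mp hX he)
  rw [Nat.card_eq_fintype_card, Fintype.card_subtype] at hcard
  rw [Finset.sum_boole]
  exact_mod_cast hcard
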